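/- Let I = (n_1, …, n_l) be a composition of n and G_i ≤ GL_{n_i}(F_q) subgroups. Assume for each 1 ≤ i ≤ l that F_q[y_1, …, y_{n_i}]^{G_i} = F_q[e_{i,1}, …, e_{i,n_i}] where e_{i,1}, …, e_{i,n_i} are algebraically independent homogeneous polynomials. For 1 ≤ j ≤ n_i define u_{i,j} = e_{i,j}(v_{i,1}, …, v_{i,n_i}) ∈ P. Then the n elements u_{i,j} (1 ≤ i ≤ l, 1 ≤ j ≤ n_i) are algebraically independent over F_q and P^{G_I} = F_q[u_{i,j} : 1 ≤ i ≤ l, 1 ≤ j ≤ n_i]. -/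

import Mathlib

open MvPolynomial Finset

/-- The action of a matrix `g` on `F_q[x_1, …, x_n]`: the algebra map sending
`x_j` to `Σ_i g_{ij} x_i`. -/
noncomputable def matAct {K : Type*} [Field K] {n : ℕ} (g : Matrix (Fin n) (Fin n) K) :
    MvPolynomial (Fin n) K →ₐ[K] MvPolynomial (Fin n) K :=
  aeval fun j => ∑ i, C (g i j) * X i

/-- The subalgebra of polynomials invariant under every matrix in `G`. -/
noncomputable def invariants {K : Type*} [Field K] {n : ℕ} (G : Set (GL (Fin n) K)) :
    Subalgebra K (MvPolynomial (Fin n) K) where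
  carrier := {f | ∀ g ∈ G, matAct ((g : GL (Fin n) K) : Matrix (Fin n) (Fin n) K) f = f}
  mul_mem' := by
    intro a b ha hb g hg
    rw [map_mul, ha g hg, hb g hg]
  add_mem' := by
    intro a b ha hb g hg
    rw [map_add, ha g hg, hb g hg]
  algebraMap_mem' := by
    intro c g hg
    simp [matAct]

/-- The ideal generated by the homogeneous `G`-invariants of positive degree;
the quotient by it is the algebra of coinvariants. -/
noncomputable def coinvIdeal {K : Type*} [Field K] {n : ℕ} (G : Set (GL (Fin n) K)) :
    Ideal (MvPolynomial (Fin n) K) :=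
  Ideal.span {f | f ∈ invariants G ∧ ∃ d, 0 < d ∧ f.IsHomogeneous d}

/-- `tauf m s` is the largest partial sum `m i` which is `≤ s`; for `s` in the
`(j+1)`-st block this is `m j`. -/
def tauf {l : ℕ} (m : Fin (l + 1) → ℕ) (s : ℕ) : ℕ :=
  ((Finset.univ : Finset (Fin (l + 1))).filter fun i => m i ≤ s).sup m

/-- `U_I`: block upper triangular matrices whose diagonal blocks are identity
matrices (blocks determined by the partial sums `m`). -/
def USet (K : Type*) [Field K] {l : ℕ} (n : ℕ) (m : Fin (l + 1) → ℕ) :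
    Set (GL (Fin n) K) :=
  {g | ∀ s t : Fin n, tauf m (t : ℕ) ≤ tauf m (s : ℕ) →
    (g : Matrix (Fin n) (Fin n) K) s t = if s = t then 1 else 0}

/-- The global index of the `j`-th variable of the `i`-th block. -/
def emb {l : ℕ} (n : ℕ) (m : Fin (l + 1) → ℕ) (hmono : StrictMono m)
    (hlast : m (Fin.last l) = n) (i : Fin l)
    (j : Fin (m i.succ - m i.castSucc)) : Fin n :=
  ⟨m i.castSucc + (j : ℕ), by
    have h1 : m i.succ ≤ n := hlast ▸ hmono.monotone (Fin.le_last _)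
    have h2 := j.2
    omega⟩

/-- `G_I`: block upper triangular matrices whose `i`-th diagonal block lies in
`G i` (and whose entries above the diagonal blocks are arbitrary). -/
def GSet (K : Type*) [Field K] {l : ℕ} (n : ℕ) (m : Fin (l + 1) → ℕ)
    (hmono : StrictMono m) (hlast : m (Fin.last l) = n)
    (G : (i : Fin l) → Subgroup (GL (Fin (m i.succ - m i.castSucc)) K)) :
    Set (GL (Fin n) K) :=
  {g | (∀ s t : Fin n, tauf m (t : ℕ) < tauf m (s : ℕ) →
          (g : Matrix (Fin n) (Fin n) K) s t = 0) ∧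
    ∀ i : Fin l, ∃ h ∈ G i, ∀ j k : Fin (m i.succ - m i.castSucc),
      (g : Matrix (Fin n) (Fin n) K) (emb n m hmono hlast i j) (emb n m hmono hlast i k) =
        (h : Matrix (Fin (m i.succ - m i.castSucc)) (Fin (m i.succ - m i.castSucc)) K) j k}

/-- `Fpoly K k hk t = Π_{(λ_1,…,λ_k) ∈ K^k} (t + λ_1 x_1 + ⋯ + λ_k x_k)`. -/
noncomputable def Fpoly (K : Type*) [Field K] [Fintype K] {n : ℕ} (k : ℕ) (hk : k ≤ n)
    (t : MvPolynomial (Fin n) K) : MvPolynomial (Fin n) K :=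
  ∏ c : Fin k → K, (t + ∑ i : Fin k, C (c i) * X (Fin.castLE hk i))

/-- `v_{i,j} = F_{m_{i-1}}(x_{m_{i-1}+j})`. -/
noncomputable def vij (K : Type*) [Field K] [Fintype K] {l : ℕ} (n : ℕ)
    (m : Fin (l + 1) → ℕ) (hmono : StrictMono m) (hlast : m (Fin.last l) = n)
    (i : Fin l) (j : Fin (m i.succ - m i.castSucc)) : MvPolynomial (Fin n) K :=
  Fpoly K (m i.castSucc)
    (le_trans (hmono.monotone (Fin.le_last _)) (le_of_eq hlast))
    (X (emb n m hmono hlast i j))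

section ShiftProd

/-- The polynomial `∏ (X + w v)` whose roots are the values of an additive map on a finite group. -/
noncomputable def shiftProd {R V : Type*} [CommRing R] [AddCommGroup V] [Fintype V]
    (w : V →+ R) : Polynomial R :=
  ∏ v, (Polynomial.X + Polynomial.C (w v))

variable {R V : Type*} [CommRing R] [AddCommGroup V] [Fintype V] (w : V →+ R)

lemma shiftProd_comp_X_add_C (v : V) :
    (shiftProd w).comp (Polynomial.X + Polynomial.C (w v)) = shiftProd w := by
  rw [shiftProd, Polynomial.prod_comp]
  refine Fintype.prod_equiv (Equiv.addLeft v) _ _ fun u => ?_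
  simp [add_assoc]

lemma shiftProd_monic : (shiftProd w).Monic :=
  Polynomial.monic_prod_of_monic _ _ fun _ _ => Polynomial.monic_X_add_C _

lemma eval_shiftProd (t : R) : (shiftProd w).eval t = ∏ v, (t + w v) := by
  simp [shiftProd, Polynomial.eval_prod]

lemma eval_shiftProd_range (v : V) : (shiftProd w).eval (w v) = 0 := by
  rw [eval_shiftProd]
  exact Finset.prod_eq_zero (Finset.mem_univ (-v)) (by simp)

lemma eval_shiftProd_add_range (t : R) (v : V) :
    (shiftProd w).eval (t + w v) = (shiftProd w).eval t := by
  simpa using congrArg (Polynomial.eval t) (shiftProd_comp_X_add_C w v)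

variable [IsDomain R]

lemma natDegree_shiftProd : (shiftProd w).natDegree = Fintype.card V := by
  rw [shiftProd, Polynomial.natDegree_prod_of_monic _ _ fun _ _ => Polynomial.monic_X_add_C _]
  simp

variable {w}

lemma eval_shiftProd_add (hw : Function.Injective w) (a b : R) :
    (shiftProd w).eval (a + b) = (shiftProd w).eval a + (shiftProd w).eval b := by
  set F := shiftProd w
  set D := F.comp (Polynomial.X + Polynomial.C b) - F - Polynomial.C (F.eval b) with hD
  have hdeg : F.natDegree = Fintype.card V := natDegree_shiftProd w
  have hpos : 0 < Fintype.card V := Fintype.card_pos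
  have hF : F.Monic := shiftProd_monic w
  have hF' : (F.comp (Polynomial.X + Polynomial.C b)).Monic :=
    hF.comp (Polynomial.monic_X_add_C b) (by simp)
  have hcard : D.degree < Fintype.card V := by
    have hdeg' : (F.comp (Polynomial.X + Polynomial.C b)).degree = F.degree := by
      rw [Polynomial.degree_eq_natDegree hF.ne_zero, Polynomial.degree_eq_natDegree hF'.ne_zero]
      simp [Polynomial.natDegree_comp]
    rw [← hdeg, ← Polynomial.degree_eq_natDegree hF.ne_zero]
    refine (Polynomial.degree_sub_le _ _).trans_lt (max_lt ?_ ?_)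
    · rw [← hdeg']
      exact Polynomial.degree_sub_lt_left hdeg' hF'.ne_zero (hF'.trans hF.symm)
    · exact Polynomial.degree_C_le.trans_lt
        (Polynomial.natDegree_pos_iff_degree_pos.mp (hdeg ▸ hpos))
  have hD0 : D = 0 := by
    refine Polynomial.eq_zero_of_degree_lt_of_eval_index_eq_zero Finset.univ
      (v := w) hw.injOn hcard fun v _ => ?_
    have h1 : F.eval (b + w v) = F.eval b := eval_shiftProd_add_range w b v
    have h2 : F.eval (w v) = 0 := eval_shiftProd_range w v
    simp [hD, h2, add_comm (w v) b, h1]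
  have := congrArg (Polynomial.eval a) hD0
  simp only [hD, Polynomial.eval_sub, Polynomial.eval_comp, Polynomial.eval_add, Polynomial.eval_X,
    Polynomial.eval_C, Polynomial.eval_zero] at this
  linear_combination this

lemma exists_eq_comp_shiftProd (hw : Function.Injective w) (p : Polynomial R)
    (hp : ∀ v, p.comp (Polynomial.X + Polynomial.C (w v)) = p) :
    ∃ g : Polynomial R, p = g.comp (shiftProd w) := by
  induction hN : p.natDegree using Nat.strong_induction_on generalizing p with
  | _ N ih =>
  have hF := shiftProd_monic w
  have hdvd : shiftProd w ∣ p - Polynomial.C (p.eval 0) := by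
    rw [← Polynomial.modByMonic_eq_zero_iff_dvd hF]
    have hlt := Polynomial.degree_modByMonic_lt (p - Polynomial.C (p.eval 0)) hF
    rw [Polynomial.degree_eq_natDegree hF.ne_zero, natDegree_shiftProd] at hlt
    refine Polynomial.eq_zero_of_degree_lt_of_eval_index_eq_zero Finset.univ
      (v := w) hw.injOn hlt fun v _ => ?_
    have h := congrArg (Polynomial.eval 0) (hp v)
    simp only [Polynomial.eval_comp, Polynomial.eval_add, Polynomial.eval_X, Polynomial.eval_C,
      zero_add] at h
    simp [Polynomial.modByMonic_eq_sub_mul_div, eval_shiftProd_range, h]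
  obtain ⟨a, ha⟩ := hdvd
  by_cases ha0 : a = 0
  · exact ⟨Polynomial.C (p.eval 0), by simpa [ha0, sub_eq_zero] using ha⟩
  obtain ⟨g, hg⟩ := ih a.natDegree (by
      have h1 : (p - Polynomial.C (p.eval 0)).natDegree = p.natDegree := Polynomial.natDegree_sub_C
      rw [ha, hF.natDegree_mul' ha0, natDegree_shiftProd] at h1
      have : 0 < Fintype.card V := Fintype.card_pos
      omega) a (fun v => by
      have h2 := congrArg (fun q => q.comp (Polynomial.X + Polynomial.C (w v))) ha
      simp only [Polynomial.sub_comp, hp v, Polynomial.mul_comp, shiftProd_comp_X_add_C,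
        Polynomial.C_comp] at h2
      exact (mul_left_cancel₀ hF.ne_zero (ha.symm.trans h2)).symm) rfl
  refine ⟨Polynomial.X * g + Polynomial.C (p.eval 0), ?_⟩
  simp only [Polynomial.add_comp, Polynomial.mul_comp, Polynomial.X_comp, Polynomial.C_comp, ← hg,
    ← ha]
  ring

end ShiftProd

section Steps

variable {K P : Type*} [Field K] [CommRing P] [Algebra K P]

lemma mem_adjoin_shiftProd_of_forall_fixed [IsDomain P] (B : Subalgebra K P) {x : P}
    (hx : Transcendental B x)
    {V : Type*} [AddCommGroup V] [Fintype V] {w : V →+ B} (hw : Function.Injective w)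
    (φ : V → P →ₐ[K] P) (hφB : ∀ v, ∀ b ∈ B, φ v b = b) (hφx : ∀ v, φ v x = x + w v)
    {f : P} (hf : f ∈ Algebra.adjoin B {x}) (hfix : ∀ v, φ v f = f) :
    f ∈ Algebra.adjoin B {∏ v, (x + (w v : P))} := by
  rw [Algebra.adjoin_singleton_eq_range_aeval] at hf ⊢
  obtain ⟨p, rfl⟩ := hf
  obtain ⟨g, rfl⟩ := exists_eq_comp_shiftProd hw p fun v => by
    let ψ : P →ₐ[B] P := { φ v with commutes' := fun b => hφB v b b.2 }
    apply transcendental_iff_injective.mp hx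
    have h : ψ (Polynomial.aeval x p) = Polynomial.aeval x p := hfix v
    rw [← Polynomial.aeval_algHom_apply, show ψ x = x + w v from hφx v] at h
    simpa [Polynomial.aeval_comp] using h
  refine ⟨g, ?_⟩
  simp [Polynomial.aeval_comp, shiftProd]

lemma mem_adjoin_aeval_of_forall_fixed (B : Subalgebra K P) {σ : Type*} {y : σ → P}
    (hy : AlgebraicIndependent B y) {Γ : Type*}
    (ψ : Γ → MvPolynomial σ K →ₐ[K] MvPolynomial σ K) (φ : Γ → P →ₐ[K] P)
    (hφB : ∀ γ, ∀ b ∈ B, φ γ b = b) (hφy : ∀ γ j, φ γ (y j) = aeval y (ψ γ (X j)))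
    {κ : Type*} (e : κ → MvPolynomial σ K)
    (he : ∀ p, (∀ γ, ψ γ p = p) → p ∈ Algebra.adjoin K (Set.range e))
    {f : P} (hf : f ∈ Algebra.adjoin B (Set.range y)) (hfix : ∀ γ, φ γ f = f) :
    f ∈ Algebra.adjoin B (Set.range fun j => aeval y (e j)) := by
  classical
  let Φ : TensorProduct K B (MvPolynomial σ K) →ₐ[B] P :=
    (aeval y).comp (algebraTensorAlgEquiv K B).toAlgHom
  have hΦ : Function.Injective Φ :=
    (show Function.Injective (aeval y) from hy).comp (algebraTensorAlgEquiv K B).injective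
  have hΦt (b : B) (p : MvPolynomial σ K) : Φ (b ⊗ₜ p) = b * aeval y p := by
    simp [Φ, algebraTensorAlgEquiv_tmul, Algebra.smul_def, aeval_map_algebraMap]
  let β := Module.Basis.ofVectorSpace K B
  have hfΦ : ∃ t, Φ t = f := by
    rw [Algebra.adjoin_range_eq_range_aeval] at hf
    obtain ⟨p, rfl⟩ := hf
    exact ⟨(algebraTensorAlgEquiv K B).symm p, by simp [Φ]⟩
  obtain ⟨t, rfl⟩ := hfΦ
  obtain ⟨c, rfl⟩ := TensorProduct.eq_repr_basis_left β t
  have hc (γ : Γ) (i) : ψ γ (c i) = c i := by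
    have hφψ (p : MvPolynomial σ K) : φ γ (aeval y p) = aeval y (ψ γ p) := by
      refine DFunLike.congr_fun (f := (φ γ).comp (aeval y)) (g := (aeval y).comp (ψ γ)) ?_ p
      ext j
      simpa using hφy γ j
    let c' := c.mapRange (ψ γ) (map_zero _)
    have h : Φ (c'.sum fun i p => β i ⊗ₜ p) = Φ (c.sum fun i p => β i ⊗ₜ p) := by
      rw [← hfix γ, Finsupp.sum_mapRange_index (by simp)]
      simp only [Finsupp.sum, map_sum, map_mul, hΦt, hφψ, hφB γ _ (β _).2]
    have h' := TensorProduct.sum_tmul_basis_left_injective β (hΦ h)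
    exact DFunLike.congr_fun h' i
  rw [Finsupp.sum, map_sum]
  refine Subalgebra.sum_mem _ fun i _ => ?_
  rw [hΦt]
  refine Subalgebra.mul_mem _ (Subalgebra.algebraMap_mem _ (β i)) ?_
  have hi := he (c i) fun γ => hc γ i
  generalize c i = p at hi ⊢
  induction hi using Algebra.adjoin_induction with
  | mem p hp =>
    obtain ⟨j, rfl⟩ := hp
    exact Algebra.subset_adjoin (Set.mem_range_self (f := fun j => aeval y (e j)) j)
  | algebraMap r =>
    rw [AlgHom.commutes, IsScalarTower.algebraMap_apply K B P]
    exact Subalgebra.algebraMap_mem _ _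
  | add p q _ _ hp hq => rw [map_add]; exact Subalgebra.add_mem _ hp hq
  | mul p q _ _ hp hq => rw [map_mul]; exact Subalgebra.mul_mem _ hp hq

end Steps

section Fpoly

variable {K : Type*} [Field K] {n : ℕ}

/-- The linear form with coefficients `c` in the first `k` variables. -/
noncomputable def linForm (K : Type*) [Field K] {n : ℕ} (k : ℕ) (hk : k ≤ n) :
    (Fin k → K) →+ MvPolynomial (Fin n) K where
  toFun c := ∑ i, C (c i) * X (Fin.castLE hk i)
  map_zero' := by simp
  map_add' c d := by simp [add_mul, Finset.sum_add_distrib]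

lemma linForm_apply (k : ℕ) (hk : k ≤ n) (c : Fin k → K) :
    linForm K k hk c = ∑ i, C (c i) * X (Fin.castLE hk i) := rfl

lemma linForm_injective (k : ℕ) (hk : k ≤ n) : Function.Injective (linForm K k hk) := by
  intro c d h
  ext j
  have := congrArg (coeff (Finsupp.single (Fin.castLE hk j) 1)) h
  simpa [linForm_apply, coeff_sum, coeff_C_mul, coeff_X, Finsupp.single_left_inj,
    (Fin.castLE_injective hk).eq_iff] using this

lemma linForm_single (k : ℕ) (hk : k ≤ n) (i : Fin k) :
    linForm K k hk (Pi.single i 1) = X (Fin.castLE hk i) := by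
  simp [linForm_apply, Pi.single_apply, apply_ite (C (σ := Fin n) (R := K)), ite_mul]

variable [Fintype K]

lemma Fpoly_eq_eval (k : ℕ) (hk : k ≤ n) (t : MvPolynomial (Fin n) K) :
    Fpoly K k hk t = (shiftProd (linForm K k hk)).eval t := by
  rw [eval_shiftProd]
  rfl

lemma Fpoly_add (k : ℕ) (hk : k ≤ n) (s t : MvPolynomial (Fin n) K) :
    Fpoly K k hk (s + t) = Fpoly K k hk s + Fpoly K k hk t := by
  simp only [Fpoly_eq_eval]
  exact eval_shiftProd_add (linForm_injective k hk) s t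

lemma Fpoly_linForm (k : ℕ) (hk : k ≤ n) (c : Fin k → K) : Fpoly K k hk (linForm K k hk c) = 0 := by
  rw [Fpoly_eq_eval, eval_shiftProd_range]

lemma Fpoly_C_mul (k : ℕ) (hk : k ≤ n) (a : K) (t : MvPolynomial (Fin n) K) :
    Fpoly K k hk (C a * t) = C a * Fpoly K k hk t := by
  by_cases ha : a = 0
  · have := Fpoly_linForm (K := K) k hk 0
    rw [map_zero] at this
    simp [ha, this]
  have hC : (C a : MvPolynomial (Fin n) K) = ∏ _c : Fin k → K, C a := by
    simp [← map_pow, FiniteField.pow_card_pow]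
  rw [hC, Fpoly, Fpoly, ← Finset.prod_mul_distrib, ← hC]
  refine Fintype.prod_equiv (MulAction.toPerm (Units.mk0 a⁻¹ (inv_ne_zero ha))) _ _ fun c => ?_
  simp only [mul_add, Finset.mul_sum, ← mul_assoc, ← C_mul]
  simp [Units.smul_def, ha]

/-- `Fpoly` as a linear map. -/
noncomputable def FpolyLinear (K : Type*) [Field K] [Fintype K] {n : ℕ} (k : ℕ) (hk : k ≤ n) :
    MvPolynomial (Fin n) K →ₗ[K] MvPolynomial (Fin n) K where
  toFun := Fpoly K k hk
  map_add' := Fpoly_add k hk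
  map_smul' a t := by simp only [smul_eq_C_mul, Fpoly_C_mul, RingHom.id_apply]

lemma Fpoly_sum {ι : Type*} (k : ℕ) (hk : k ≤ n) (s : Finset ι) (a : ι → K)
    (t : ι → MvPolynomial (Fin n) K) :
    Fpoly K k hk (∑ i ∈ s, C (a i) * t i) = ∑ i ∈ s, C (a i) * Fpoly K k hk (t i) := by
  simp only [← smul_eq_C_mul]
  exact (map_sum (FpolyLinear K k hk) _ s).trans (by simp [FpolyLinear, smul_eq_C_mul, Fpoly_C_mul])

lemma Fpoly_X_of_lt (k : ℕ) (hk : k ≤ n) {s : Fin n} (hs : (s : ℕ) < k) :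
    Fpoly K k hk (X s) = 0 := by
  have := linForm_single (K := K) k hk ⟨s, hs⟩
  rw [show Fin.castLE hk ⟨s, hs⟩ = s from rfl] at this
  rw [← this, Fpoly_linForm]

end Fpoly

section MatAct

variable {K : Type*} [Field K] {n : ℕ}

lemma matAct_X (g : Matrix (Fin n) (Fin n) K) (j : Fin n) :
    matAct g (X j) = ∑ i, C (g i j) * X i := by
  simp [matAct]

lemma matAct_mul (g h : Matrix (Fin n) (Fin n) K) (f : MvPolynomial (Fin n) K) :
    matAct (g * h) f = matAct g (matAct h f) := by
  refine DFunLike.congr_fun (f := matAct (g * h)) (g := (matAct g).comp (matAct h)) ?_ f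
  ext1 j
  simp only [AlgHom.comp_apply, matAct_X, map_sum, map_mul, algHom_C, Matrix.mul_apply,
    Finset.mul_sum, Finset.sum_mul, algebraMap_eq]
  rw [Finset.sum_comm]
  refine Finset.sum_congr rfl fun _ _ => Finset.sum_congr rfl fun _ _ => by ring

lemma matAct_one (f : MvPolynomial (Fin n) K) :
    matAct (1 : Matrix (Fin n) (Fin n) K) f = f := by
  refine DFunLike.congr_fun (f := matAct 1) (g := AlgHom.id K _) ?_ f
  ext1 j
  simp [matAct_X, Matrix.one_apply, apply_ite (C (σ := Fin n) (R := K)), ite_mul]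

lemma matAct_injective (g : GL (Fin n) K) :
    Function.Injective (matAct (g : Matrix (Fin n) (Fin n) K)) := by
  refine Function.LeftInverse.injective
    (g := matAct ((g⁻¹ : GL (Fin n) K) : Matrix (Fin n) (Fin n) K)) fun f => ?_
  rw [← matAct_mul, ← Units.val_mul, inv_mul_cancel, Units.val_one, matAct_one]

lemma matAct_linForm (k : ℕ) (hk : k ≤ n) (g : Matrix (Fin n) (Fin n) K)
    (hg : ∀ s t : Fin n, (t : ℕ) < k → k ≤ (s : ℕ) → g s t = 0) (c : Fin k → K) :
    matAct g (linForm K k hk c) =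
      linForm K k hk ((g.submatrix (Fin.castLE hk) (Fin.castLE hk)).mulVec c) := by
  have hX (i : Fin k) : matAct g (X (Fin.castLE hk i)) =
      ∑ s : Fin k, C (g (Fin.castLE hk s) (Fin.castLE hk i)) * X (Fin.castLE hk s) := by
    rw [matAct_X]
    refine (Fintype.sum_of_injective _ (Fin.castLE_injective hk) _ _ (fun s hs => ?_)
      fun s => rfl).symm
    have : k ≤ (s : ℕ) := by
      by_contra h
      exact hs ⟨⟨s, by omega⟩, rfl⟩
    rw [hg s _ (by simp) this, C_0, zero_mul]
  simp only [linForm_apply, map_sum, map_mul, hX, algHom_C, Matrix.mulVec, dotProduct,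
    Finset.mul_sum, Finset.sum_mul, algebraMap_eq, Matrix.submatrix_apply]
  rw [Finset.sum_comm]
  refine Finset.sum_congr rfl fun _ _ => Finset.sum_congr rfl fun _ _ => by ring

lemma matAct_Fpoly [Fintype K] (k : ℕ) (hk : k ≤ n) (g : GL (Fin n) K)
    (hg : ∀ s t : Fin n, (t : ℕ) < k → k ≤ (s : ℕ) → (g : Matrix (Fin n) (Fin n) K) s t = 0)
    (t : MvPolynomial (Fin n) K) :
    matAct (g : Matrix (Fin n) (Fin n) K) (Fpoly K k hk t) =
      Fpoly K k hk (matAct (g : Matrix (Fin n) (Fin n) K) t) := by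
  set A := (g : Matrix (Fin n) (Fin n) K).submatrix (Fin.castLE hk) (Fin.castLE hk)
  have hA : Function.Injective A.mulVec := fun c d h => by
    apply linForm_injective (K := K) k hk
    apply matAct_injective g
    rw [matAct_linForm k hk _ hg, matAct_linForm k hk _ hg]
    exact congrArg _ h
  rw [Fpoly_eq_eval, Fpoly_eq_eval, eval_shiftProd, eval_shiftProd, map_prod]
  refine Fintype.prod_bijective _ (Finite.injective_iff_bijective.mp hA) _ _ fun c => ?_
  rw [map_add, matAct_linForm k hk _ hg]

end MatAct

section Index

variable {l n : ℕ} {m : Fin (l + 1) → ℕ} (hmono : StrictMono m) (hlast : m (Fin.last l) = n)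

lemma tauf_mono (m : Fin (l + 1) → ℕ) : Monotone (tauf m) := fun _ _ h =>
  Finset.sup_mono (Finset.monotone_filter_right _ fun _ _ h' => h'.trans h)

lemma tauf_le (m : Fin (l + 1) → ℕ) (s : ℕ) : tauf m s ≤ s :=
  Finset.sup_le fun _ hi => (Finset.mem_filter.mp hi).2

lemma tauf_emb (i : Fin l) (j) : tauf m (emb n m hmono hlast i j) = m i.castSucc := by
  apply le_antisymm
  · refine Finset.sup_le fun k hk => hmono.monotone ?_
    have h1 : m k ≤ m i.castSucc + j := (Finset.mem_filter.mp hk).2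
    have h2 : k < i.succ := hmono.lt_iff_lt.mp (by have := j.2; omega)
    exact Fin.le_castSucc_iff.mpr h2
  · exact Finset.le_sup (f := m)
      (Finset.mem_filter.mpr ⟨Finset.mem_univ _, Nat.le_add_right _ _⟩)

lemma emb_bijective (hm0 : m 0 = 0) : Function.Bijective
    fun x : Σ i : Fin l, Fin (m i.succ - m i.castSucc) => emb n m hmono hlast x.1 x.2 := by
  constructor
  · rintro ⟨i, j⟩ ⟨i', j'⟩ h
    have h1 := congrArg (fun s : Fin n => tauf m s) h
    simp only [tauf_emb] at h1
    obtain rfl : i = i' := Fin.castSucc_injective _ (hmono.injective h1)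
    have h2 : m i.castSucc + (j : ℕ) = m i.castSucc + (j' : ℕ) := congrArg Fin.val h
    obtain rfl : j = j' := Fin.ext (by omega)
    rfl
  · intro s
    by_contra! h
    have hle : ∀ i : Fin (l + 1), m i ≤ s := by
      intro i
      induction i using Fin.induction with
      | zero => omega
      | succ i ih =>
        by_contra! hi
        exact h ⟨i, ⟨s - m i.castSucc, by omega⟩⟩ (Fin.ext (by simp [emb]; omega))
    have := hle (Fin.last l)
    omega

/-- The enumeration of all variables block by block. -/
noncomputable def embEquiv (hm0 : m 0 = 0) :
    (Σ i : Fin l, Fin (m i.succ - m i.castSucc)) ≃ Fin n :=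
  Equiv.ofBijective _ (emb_bijective hmono hlast hm0)

end Index

section BlockTriangular

variable {K : Type*} [Field K] [Fintype K] {l n : ℕ} {m : Fin (l + 1) → ℕ}
  (hmono : StrictMono m) (hlast : m (Fin.last l) = n)

lemma vij_eq (i : Fin l) (j) : vij K n m hmono hlast i j =
    Fpoly K (tauf m (emb n m hmono hlast i j)) ((tauf_le m _).trans (Fin.is_le'))
      (X (emb n m hmono hlast i j)) := by
  unfold vij
  congr 1
  exact (tauf_emb hmono hlast i j).symm

lemma matAct_vij (hm0 : m 0 = 0) (g : GL (Fin n) K)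
    (hg : ∀ s t : Fin n, tauf m (t : ℕ) < tauf m (s : ℕ) →
      (g : Matrix (Fin n) (Fin n) K) s t = 0) (i : Fin l) (k) :
    matAct (g : Matrix (Fin n) (Fin n) K) (vij K n m hmono hlast i k) =
      ∑ j, C ((g : Matrix (Fin n) (Fin n) K) (emb n m hmono hlast i j) (emb n m hmono hlast i k)) *
        vij K n m hmono hlast i j := by
  have hle : m i.castSucc ≤ n := hlast ▸ hmono.monotone (Fin.le_last _)
  have hpos : 0 < m i.succ - m i.castSucc := by have := k.2; omega
  rw [vij, matAct_Fpoly, matAct_X, Fpoly_sum, ← (embEquiv hmono hlast hm0).sum_comp,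
    Fintype.sum_sigma, Finset.sum_eq_single i]
  · rfl
  · intro i' _ hi'
    refine Finset.sum_eq_zero fun j _ => ?_
    rcases lt_or_gt_of_ne hi' with h | h
    · rw [Fpoly_X_of_lt, mul_zero]
      have h1 : m i'.succ ≤ m i.castSucc := hmono.monotone (Fin.succ_le_castSucc_iff.mpr h)
      have := j.2
      simp only [embEquiv, Equiv.ofBijective_apply, emb]
      omega
    · rw [hg, C_0, zero_mul]
      simp only [embEquiv, Equiv.ofBijective_apply, tauf_emb]
      exact hmono (Fin.castSucc_lt_castSucc_iff.mpr h)
  · simp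
  · intro s t ht hs
    apply hg
    have h1 := tauf_le m t
    have h2 := tauf_emb hmono hlast i ⟨0, hpos⟩
    have h3 := tauf_mono m hs
    simp only [emb, Nat.add_zero] at h2
    omega

end BlockTriangular

section Algebraic

variable {K : Type*} [Field K]

lemma algebraicIndependent_of_isAlgebraic_X {n : ℕ} {ι : Type*} [Fintype ι]
    (hι : Fintype.card ι = n) (z : ι → MvPolynomial (Fin n) K)
    (h : ∀ s, IsAlgebraic (Algebra.adjoin K (Set.range z)) (X s : MvPolynomial (Fin n) K)) :
    AlgebraicIndependent K z := by
  set S := Algebra.adjoin K (Set.range z)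
  have htop : (⊤ : Subalgebra K (MvPolynomial (Fin n) K)) ≤
      (Subalgebra.algebraicClosure S (MvPolynomial (Fin n) K)).restrictScalars K := by
    rw [← adjoin_range_X, Algebra.adjoin_le_iff]
    rintro _ ⟨s, rfl⟩
    exact h s
  have : Algebra.IsAlgebraic S (MvPolynomial (Fin n) K) := ⟨fun x => htop trivial⟩
  refine (Algebra.IsAlgebraic.isTranscendenceBasis_of_lift_le_trdeg_of_finite K z ?_).1
  rw [trdeg_of_isDomain]
  simp [hι]

lemma isAlgebraic_of_aeval_mem {σ P : Type*} [Finite σ] [CommRing P] [IsDomain P] [Algebra K P]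
    {e : σ → MvPolynomial σ K} (he : AlgebraicIndependent K e) {y : σ → P}
    (hy : AlgebraicIndependent K y) (S : Subalgebra K P) (hS : ∀ j, aeval y (e j) ∈ S) (j : σ) :
    IsAlgebraic S (y j) := by
  have hb : IsTranscendenceBasis K e := he.isTranscendenceBasis_of_lift_trdeg_le_of_finite (by
    rw [trdeg_of_isDomain]; simp)
  have halg : Algebra.IsAlgebraic (Algebra.adjoin K (Set.range e)) (MvPolynomial σ K) :=
    hb.isAlgebraic
  have hle : Algebra.adjoin K (Set.range e) ≤ S.comap (aeval y) := by
    rw [Algebra.adjoin_le_iff]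
    rintro _ ⟨j, rfl⟩
    exact hS j
  let f : Algebra.adjoin K (Set.range e) →ₐ[K] S :=
    ((aeval y).comp (Algebra.adjoin K (Set.range e)).val).codRestrict S fun x => hle x.2
  have hf : Function.Injective f := fun a b hab => by
    have h : aeval y (a : MvPolynomial σ K) = aeval y (b : MvPolynomial σ K) :=
      congrArg Subtype.val hab
    exact Subtype.ext (hy h)
  have := (halg.isAlgebraic (X j)).ringHom_of_comp_eq f (aeval y : MvPolynomial σ K →ₐ[K] P) hf rfl
  rwa [aeval_X] at this

lemma isAlgebraic_of_prod_add {S P V : Type*} [CommRing S] [IsDomain S] [CommRing P] [IsDomain P]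
    [Algebra S P] [FaithfulSMul S P] [AddCommGroup V] [Fintype V] {w : V →+ P}
    (hw : ∀ v, IsAlgebraic S (w v)) {x : P} (hx : IsAlgebraic S (∏ v, (x + w v))) :
    IsAlgebraic S x := by
  let A := Subalgebra.algebraicClosure S P
  let q : Polynomial A := shiftProd (R := A) (w.codRestrict A hw) - Polynomial.C (⟨_, hx⟩ : A)
  have hq : q ≠ 0 := fun h0 => by
    have := congrArg Polynomial.natDegree h0
    rw [Polynomial.natDegree_sub_C, natDegree_shiftProd, Polynomial.natDegree_zero] at this
    exact Fintype.card_ne_zero this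
  have halg : IsAlgebraic A x := ⟨q, hq, by
    simp only [q, map_sub, shiftProd, map_prod, map_add, Polynomial.aeval_X, Polynomial.aeval_C]
    exact sub_self _⟩
  exact halg.restrictScalars S

lemma isAlgebraic_X_of_Fpoly [Fintype K] {n : ℕ} (τ : Fin n → ℕ) (hτ : ∀ s, τ s ≤ s)
    (S : Subalgebra K (MvPolynomial (Fin n) K))
    (h : ∀ s, IsAlgebraic S (X s : MvPolynomial (Fin n) K) ∨
      IsAlgebraic S (Fpoly K (τ s) ((hτ s).trans Fin.is_le') (X s))) (s : Fin n) :
    IsAlgebraic S (X s : MvPolynomial (Fin n) K) := by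
  induction s using WellFoundedLT.induction with
  | _ s ih =>
  refine (h s).elim id fun hs => ?_
  have hX (i : Fin (τ s)) : IsAlgebraic S (X (Fin.castLE ((hτ s).trans Fin.is_le') i)) :=
    ih _ (Fin.lt_def.mpr (i.2.trans_le (hτ s)))
  have hC (a : K) : IsAlgebraic S (C a : MvPolynomial (Fin n) K) :=
    isAlgebraic_algebraMap (algebraMap K S a)
  refine isAlgebraic_of_prod_add (w := linForm K (τ s) ((hτ s).trans Fin.is_le')) (fun c => ?_) hs
  rw [linForm_apply]
  exact (Subalgebra.algebraicClosure S _).sum_mem fun i _ => (hC (c i)).mul (hX i)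

end Algebraic

section Transvection

variable {K : Type*} [Field K] {n : ℕ}

lemma exists_transvection (k : ℕ) (s : Fin n) (hks : k ≤ s) (c : Fin k → K) :
    ∃ g : GL (Fin n) K,
      (∀ i j : Fin n, ¬ (j = s ∧ (i : ℕ) < k) →
        (g : Matrix (Fin n) (Fin n) K) i j = if i = j then 1 else 0) ∧
      matAct (g : Matrix (Fin n) (Fin n) K) (X s) =
        X s + linForm K k (hks.trans Fin.is_le') c := by
  let N : Matrix (Fin n) (Fin n) K := fun i j =>
    if j = s then (if h : (i : ℕ) < k then c ⟨i, h⟩ else 0) else 0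
  have hN : N * N = 0 := by
    ext i j
    rw [Matrix.mul_apply]
    refine Finset.sum_eq_zero fun r _ => ?_
    by_cases hr : r = s
    · have : ¬ (r : ℕ) < k := by subst hr; omega
      simp [N, this]
    · simp [N, hr]
  refine ⟨⟨1 + N, 1 - N, by noncomm_ring; simp [hN], by noncomm_ring; simp [hN]⟩,
    fun i j h => ?_, ?_⟩
  · have : N i j = 0 := by
      by_cases hj : j = s
      · have hi : ¬ (i : ℕ) < k := fun hi => h ⟨hj, hi⟩
        simp [N, hi]
      · simp [N, hj]
    simp [this, Matrix.one_apply]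
  · rw [matAct_X]
    simp only [Matrix.add_apply, map_add, add_mul, Finset.sum_add_distrib]
    congr 1
    · simp [Matrix.one_apply, apply_ite (C (σ := Fin n) (R := K)), ite_mul]
    · rw [linForm_apply]
      refine (Fintype.sum_of_injective _ (Fin.castLE_injective (hks.trans Fin.is_le')) _ _
        (fun i hi => ?_) fun i => by simp [N]).symm
      have : ¬ (i : ℕ) < k := fun h => hi ⟨⟨i, h⟩, rfl⟩
      simp [N, this]

lemma matAct_X_of_col {g : Matrix (Fin n) (Fin n) K} {j : Fin n}
    (hg : ∀ i, g i j = if i = j then 1 else 0) : matAct g (X j) = X j := by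
  simp [matAct_X, hg, apply_ite (C (σ := Fin n) (R := K)), ite_mul]

lemma mem_adjoin_of_forall_fixed {P : Type*} [CommRing P] [Algebra K P] {s : Set P}
    (φ : P →ₐ[K] P) (h : ∀ x ∈ s, φ x = x) : ∀ b ∈ Algebra.adjoin K s, φ b = b := by
  have : Algebra.adjoin K s ≤ AlgHom.equalizer φ (AlgHom.id K P) := Algebra.adjoin_le h
  exact fun b hb => this hb

/-- A polynomial fixed by all the substitutions `x_s ↦ x_s + w`, `w` a linear form in the first
`τ s` variables, is a polynomial in the `F_{τ s}(x_s)`. -/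
lemma mem_adjoin_Fpoly [Fintype K] (τ : Fin n → ℕ) (hτ : ∀ s, τ s ≤ s)
    (f : MvPolynomial (Fin n) K)
    (hf : ∀ (s : Fin n) (g : GL (Fin n) K), (∀ i j : Fin n, ¬ (j = s ∧ (i : ℕ) < τ s) →
        (g : Matrix (Fin n) (Fin n) K) i j = if i = j then 1 else 0) →
      matAct (g : Matrix (Fin n) (Fin n) K) f = f) :
    f ∈ Algebra.adjoin K
      (Set.range fun s => Fpoly K (τ s) ((hτ s).trans Fin.is_le') (X s)) := by
  let v : Fin n → MvPolynomial (Fin n) K := fun s => Fpoly K (τ s) ((hτ s).trans Fin.is_le') (X s)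
  let z : ℕ → Fin n → MvPolynomial (Fin n) K := fun k s => if k ≤ s then v s else X s
  have hz (k : ℕ) : AlgebraicIndependent K (z k) := by
    refine algebraicIndependent_of_isAlgebraic_X (by simp) _
      (isAlgebraic_X_of_Fpoly τ hτ _ fun s => ?_)
    have hs : z k s ∈ Algebra.adjoin K (Set.range (z k)) := Algebra.subset_adjoin ⟨s, rfl⟩
    have halg : IsAlgebraic (Algebra.adjoin K (Set.range (z k))) (z k s) :=
      isAlgebraic_algebraMap (⟨z k s, hs⟩ : Algebra.adjoin K (Set.range (z k)))
    by_cases h : k ≤ s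
    · have : z k s = v s := if_pos h
      exact Or.inr (this ▸ halg :)
    · have : z k s = X s := if_neg h
      exact Or.inl (this ▸ halg :)
  have hrange (y : Fin n → MvPolynomial (Fin n) K) (s : Fin n) :
      Set.range y = y '' {s}ᶜ ∪ {y s} := by
    rw [← Set.image_singleton, ← Set.image_union, Set.compl_union_self, Set.image_univ]
  have main : ∀ k ≤ n, f ∈ Algebra.adjoin K (Set.range (z k)) := by
    intro k hk
    induction hk using Nat.decreasingInduction with
    | self =>
      have : z n = X := by
        ext1 s
        have : ¬ n ≤ s := by omega
        simp [z, this]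
      rw [this, adjoin_range_X]
      trivial
    | of_succ k hk ih =>
      let s : Fin n := ⟨k, hk⟩
      have hoff : ∀ t ≠ s, z k t = z (k + 1) t := fun t ht => by
        have : (t : ℕ) ≠ k := fun h => ht (Fin.ext h)
        have : k ≤ t ↔ k + 1 ≤ t := by omega
        simp only [z, this]
      have himage : z k '' {s}ᶜ = z (k + 1) '' {s}ᶜ := Set.image_congr fun t ht => hoff t ht
      have hzs : z (k + 1) s = X s := by simp [z, s]
      have hzs' : z k s = v s := by simp [z, s]
      rw [hrange _ s, hzs, Algebra.adjoin_union_eq_adjoin_adjoin] at ih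
      rw [hrange _ s, hzs', himage, Algebra.adjoin_union_eq_adjoin_adjoin]
      set B := Algebra.adjoin K (z (k + 1) '' {s}ᶜ)
      have htr : Transcendental B (X s : MvPolynomial (Fin n) K) := by
        have := (hz (k + 1)).transcendental_adjoin (s := {s}ᶜ) (i := s) (by simp)
        rwa [hzs] at this
      let w : (Fin (τ s) → K) →+ B := (linForm K (τ s) ((hτ s).trans Fin.is_le')).codRestrict B
        fun c => by
          rw [linForm_apply]
          refine B.sum_mem fun i _ => B.mul_mem (B.algebraMap_mem (c i)) ?_
          have h2 : (i : ℕ) < k := i.2.trans_le (hτ s)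
          refine Algebra.subset_adjoin ⟨Fin.castLE ((hτ s).trans Fin.is_le') i, fun h => ?_, ?_⟩
          · exact h2.ne (congrArg Fin.val h)
          · have : ¬ k + 1 ≤ (i : ℕ) := by omega
            simp [z, this]
      have hw : Function.Injective w := fun c d h =>
        linForm_injective (τ s) ((hτ s).trans Fin.is_le') (congrArg Subtype.val h)
      choose g hg hgs using exists_transvection (K := K) (τ s) s (hτ s)
      refine mem_adjoin_shiftProd_of_forall_fixed B htr hw
        (fun c => matAct (g c : Matrix (Fin n) (Fin n) K)) (fun c => ?_) hgs ih
        fun c => hf s (g c) (hg c)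
      refine mem_adjoin_of_forall_fixed _ ?_
      rintro _ ⟨t, ht, rfl⟩
      have hX : matAct (g c : Matrix (Fin n) (Fin n) K) (X t) = X t :=
        matAct_X_of_col fun i => hg c i t fun h => ht h.1
      by_cases hkt : k + 1 ≤ t
      · simp only [z, hkt, if_true, v]
        rw [matAct_Fpoly, hX]
        intro i j hj hi
        have hsi := hτ s
        rw [hg c i j, if_neg]
        · rintro rfl; omega
        · rintro ⟨rfl, h⟩; omega
      · simp only [z, hkt, if_false, hX]
  have := main 0 (Nat.zero_le n)
  simpa [z] using this

end Transvection

section Blocks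

variable {K : Type*} [Field K] {l n : ℕ} {m : Fin (l + 1) → ℕ}
  (hmono : StrictMono m) (hlast : m (Fin.last l) = n)

lemma tauf_embEquiv (hm0 : m 0 = 0) (x) :
    tauf m (embEquiv hmono hlast hm0 x) = m x.1.castSucc :=
  tauf_emb hmono hlast x.1 x.2

/-- Block diagonal matrices with prescribed invertible blocks. -/
lemma exists_blockDiagonal (hm0 : m 0 = 0)
    (h : (i : Fin l) → GL (Fin (m i.succ - m i.castSucc)) K) :
    ∃ g : GL (Fin n) K,
      (∀ s t : Fin n, tauf m (t : ℕ) < tauf m (s : ℕ) →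
        (g : Matrix (Fin n) (Fin n) K) s t = 0) ∧
      ∀ i j k, (g : Matrix (Fin n) (Fin n) K) (emb n m hmono hlast i j) (emb n m hmono hlast i k) =
        (h i : Matrix (Fin (m i.succ - m i.castSucc)) (Fin (m i.succ - m i.castSucc)) K) j k := by
  let E := embEquiv hmono hlast hm0
  let g : GL (Fin n) K := Units.map
    ((Matrix.reindexAlgEquiv K K E).toRingEquiv.toRingHom.comp
      (Matrix.blockDiagonal'RingHom _ K) : _ →* _) (MulEquiv.piUnits.symm h)
  have hg (x y) : (g : Matrix (Fin n) (Fin n) K) (E x) (E y) =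
      Matrix.blockDiagonal' (fun i => (h i : Matrix _ _ K)) x y := by
    simp [g]
    rfl
  refine ⟨g, fun s t hst => ?_, fun i j k => ?_⟩
  · obtain ⟨x, rfl⟩ := E.surjective s
    obtain ⟨y, rfl⟩ := E.surjective t
    rw [hg, Matrix.blockDiagonal'_apply, dif_neg]
    intro hxy
    simp only [E, tauf_embEquiv, hxy] at hst
    exact hst.false
  · exact (hg ⟨i, j⟩ ⟨i, k⟩).trans (Matrix.blockDiagonal'_apply_eq _ _ _ _)

/-- A block upper triangular matrix acts on polynomials in the `i`-th block `v_{i,1}, …` through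
its `i`-th diagonal block. -/
lemma matAct_aeval_vij [Fintype K] (hm0 : m 0 = 0) (g : GL (Fin n) K)
    (hg : ∀ s t : Fin n, tauf m (t : ℕ) < tauf m (s : ℕ) →
      (g : Matrix (Fin n) (Fin n) K) s t = 0) (i : Fin l)
    (h : Matrix (Fin (m i.succ - m i.castSucc)) (Fin (m i.succ - m i.castSucc)) K)
    (hgh : ∀ j k, (g : Matrix (Fin n) (Fin n) K) (emb n m hmono hlast i j)
      (emb n m hmono hlast i k) = h j k)
    (f : MvPolynomial (Fin (m i.succ - m i.castSucc)) K) :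
    matAct (g : Matrix (Fin n) (Fin n) K) (aeval (vij K n m hmono hlast i) f) =
      aeval (vij K n m hmono hlast i) (matAct h f) := by
  refine DFunLike.congr_fun (f := (matAct (g : Matrix (Fin n) (Fin n) K)).comp
    (aeval (vij K n m hmono hlast i))) (g := (aeval (vij K n m hmono hlast i)).comp (matAct h)) ?_ f
  ext1 k
  simp only [AlgHom.comp_apply, aeval_X, matAct_vij hmono hlast hm0 g hg, matAct_X, map_sum,
    map_mul, hgh, algHom_C, algebraMap_eq]

/-- Matrices differing from the identity only in column `s`, in the rows of earlier blocks, belong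
to every parabolic group `G_I`. -/
lemma mem_GSet_of_col (G : (i : Fin l) → Subgroup (GL (Fin (m i.succ - m i.castSucc)) K))
    (s : Fin n) (g : GL (Fin n) K)
    (hg : ∀ i j : Fin n, ¬ (j = s ∧ (i : ℕ) < tauf m s) →
      (g : Matrix (Fin n) (Fin n) K) i j = if i = j then 1 else 0) :
    g ∈ GSet K n m hmono hlast G := by
  refine ⟨fun i j hij => ?_, fun i => ⟨1, one_mem _, fun j k => ?_⟩⟩
  · rw [hg, if_neg]
    · rintro rfl
      exact hij.false
    · rintro ⟨rfl, hi⟩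
      exact hij.not_ge (tauf_mono m (hi.le.trans (tauf_le m j)))
  · have hinj : emb n m hmono hlast i j = emb n m hmono hlast i k ↔ j = k := by
      simp [emb, Fin.ext_iff]
    rw [hg, Units.val_one, Matrix.one_apply]
    · simp only [hinj]
    · rintro ⟨rfl, hj⟩
      rw [tauf_emb] at hj
      simp [emb] at hj

end Blocks

section Generators

variable {K : Type*} [Field K] [Fintype K] {l n : ℕ} {m : Fin (l + 1) → ℕ}
  (hmono : StrictMono m) (hlast : m (Fin.last l) = n)
  (e : (i : Fin l) → Fin (m i.succ - m i.castSucc) →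
    MvPolynomial (Fin (m i.succ - m i.castSucc)) K)

/-- The family consisting of the `u_{i,j}` for the blocks `i ∈ S`, and of the `v_{i,j}` for the
other blocks. -/
noncomputable def mixedGens (S : Finset (Fin l)) (x : Σ i : Fin l, Fin (m i.succ - m i.castSucc)) :
    MvPolynomial (Fin n) K :=
  if x.1 ∈ S then aeval (vij K n m hmono hlast x.1) (e x.1 x.2) else vij K n m hmono hlast x.1 x.2

lemma mixedGens_of_mem {S : Finset (Fin l)} {i : Fin l} (hi : i ∈ S) (j) :
    mixedGens hmono hlast e S ⟨i, j⟩ = aeval (vij K n m hmono hlast i) (e i j) := if_pos hi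

lemma mixedGens_of_notMem {S : Finset (Fin l)} {i : Fin l} (hi : i ∉ S) (j) :
    mixedGens hmono hlast e S ⟨i, j⟩ = vij K n m hmono hlast i j := if_neg hi

lemma range_vij (hm0 : m 0 = 0) :
    (Set.range fun x : Σ i : Fin l, Fin (m i.succ - m i.castSucc) =>
        vij K n m hmono hlast x.1 x.2) =
      Set.range fun s : Fin n => Fpoly K (tauf m s) ((tauf_le m _).trans Fin.is_le') (X s) := by
  rw [← (embEquiv hmono hlast hm0).surjective.range_comp]
  exact congrArg _ (funext fun x => vij_eq hmono hlast x.1 x.2)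

lemma algebraicIndependent_of_isAlgebraic_vij (hm0 : m 0 = 0)
    (z : (Σ i : Fin l, Fin (m i.succ - m i.castSucc)) → MvPolynomial (Fin n) K)
    (hz : ∀ i j, IsAlgebraic (Algebra.adjoin K (Set.range z)) (vij K n m hmono hlast i j)) :
    AlgebraicIndependent K z := by
  refine algebraicIndependent_of_isAlgebraic_X
    (by rw [Fintype.card_congr (embEquiv hmono hlast hm0), Fintype.card_fin]) z
    (isAlgebraic_X_of_Fpoly (fun s : Fin n => tauf m s) (fun s => tauf_le m s) _ fun s => Or.inr ?_)
  obtain ⟨⟨i, j⟩, rfl⟩ := (embEquiv hmono hlast hm0).surjective s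
  have h := hz i j
  rw [vij_eq] at h
  exact h

lemma algebraicIndependent_vij (hm0 : m 0 = 0) : AlgebraicIndependent K
    fun x : Σ i : Fin l, Fin (m i.succ - m i.castSucc) => vij K n m hmono hlast x.1 x.2 :=
  algebraicIndependent_of_isAlgebraic_vij hmono hlast hm0 _ fun i j =>
    isAlgebraic_algebraMap (⟨vij K n m hmono hlast i j, Algebra.subset_adjoin ⟨⟨i, j⟩, rfl⟩⟩ :
      Algebra.adjoin K (Set.range fun x : Σ i : Fin l, Fin (m i.succ - m i.castSucc) =>
        vij K n m hmono hlast x.1 x.2))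

lemma algebraicIndependent_mixedGens (hm0 : m 0 = 0) (hind : ∀ i, AlgebraicIndependent K (e i))
    (S : Finset (Fin l)) : AlgebraicIndependent K (mixedGens hmono hlast e S) := by
  refine algebraicIndependent_of_isAlgebraic_vij hmono hlast hm0 _ fun i j => ?_
  have hmem (j) : mixedGens hmono hlast e S ⟨i, j⟩ ∈
      Algebra.adjoin K (Set.range (mixedGens hmono hlast e S)) := Algebra.subset_adjoin ⟨_, rfl⟩
  by_cases hi : i ∈ S
  · refine isAlgebraic_of_aeval_mem (hind i) (y := vij K n m hmono hlast i) ?_ _ (fun j => ?_) j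
    · exact (algebraicIndependent_vij hmono hlast hm0).comp (Sigma.mk i) sigma_mk_injective
    · exact mixedGens_of_mem hmono hlast e hi j ▸ hmem j
  · exact mixedGens_of_notMem hmono hlast e hi j ▸ isAlgebraic_algebraMap
      (⟨_, hmem j⟩ : Algebra.adjoin K (Set.range (mixedGens hmono hlast e S)))

variable (G : (i : Fin l) → Subgroup (GL (Fin (m i.succ - m i.castSucc)) K))

lemma mem_adjoin_mixedGens (hm0 : m 0 = 0) (hind : ∀ i, AlgebraicIndependent K (e i))
    (hgen : ∀ i, Algebra.adjoin K (Set.range (e i)) =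
      invariants ((G i : Set (GL (Fin (m i.succ - m i.castSucc)) K))))
    {f : MvPolynomial (Fin n) K} (hf : f ∈ invariants (GSet K n m hmono hlast G))
    (S : Finset (Fin l)) : f ∈ Algebra.adjoin K (Set.range (mixedGens hmono hlast e S)) := by
  induction S using Finset.induction_on with
  | empty =>
    have : mixedGens hmono hlast e ∅ = fun x => vij K n m hmono hlast x.1 x.2 :=
      funext fun x => mixedGens_of_notMem hmono hlast e (Finset.notMem_empty _) x.2
    rw [this, range_vij hmono hlast hm0]
    exact mem_adjoin_Fpoly _ (fun s => tauf_le m s) f fun s g hg =>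
      hf g (mem_GSet_of_col hmono hlast G s g hg)
  | insert i S hi ih =>
    have hrange (z : (Σ i : Fin l, Fin (m i.succ - m i.castSucc)) → MvPolynomial (Fin n) K) :
        Set.range z = z '' {x | x.1 ≠ i} ∪ Set.range fun j => z ⟨i, j⟩ := by
      ext p
      constructor
      · rintro ⟨⟨i', j⟩, rfl⟩
        by_cases h : i' = i
        · subst h
          exact Or.inr ⟨j, rfl⟩
        · exact Or.inl ⟨_, h, rfl⟩
      · rintro (⟨x, -, rfl⟩ | ⟨j, rfl⟩) <;> exact ⟨_, rfl⟩
    have himage : mixedGens hmono hlast e (insert i S) '' {x | x.1 ≠ i} =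
        mixedGens hmono hlast e S '' {x | x.1 ≠ i} :=
      Set.image_congr fun x hx => by
        have : x.1 ∈ insert i S ↔ x.1 ∈ S := Finset.mem_insert.trans (or_iff_right hx)
        simp only [mixedGens, this]
    have hu : (fun j => mixedGens hmono hlast e (insert i S) ⟨i, j⟩) =
        fun j => aeval (vij K n m hmono hlast i) (e i j) :=
      funext (mixedGens_of_mem hmono hlast e (Finset.mem_insert_self i S))
    have hv : (fun j => mixedGens hmono hlast e S ⟨i, j⟩) = vij K n m hmono hlast i :=
      funext (mixedGens_of_notMem hmono hlast e hi)
    rw [hrange, hv, Algebra.adjoin_union_eq_adjoin_adjoin] at ih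
    rw [hrange, himage, hu, Algebra.adjoin_union_eq_adjoin_adjoin]
    set B := Algebra.adjoin K (mixedGens hmono hlast e S '' {x | x.1 ≠ i})
    have hy : AlgebraicIndependent B (vij K n m hmono hlast i) := by
      have h := (algebraicIndependent_mixedGens hmono hlast e hm0 hind S).adjoin_of_disjoint
        (s := {x | x.1 ≠ i}) (t := {x | x.1 = i})
        (Set.disjoint_left.mpr fun x hx hx' => hx hx')
      have h' := h.comp (fun j => ⟨⟨i, j⟩, rfl⟩) fun j k hjk => by
          simpa using hjk
      exact hv ▸ h'
    choose b hb0 hb using exists_blockDiagonal (K := K) hmono hlast hm0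
    let H (h : G i) : (i : Fin l) → GL (Fin (m i.succ - m i.castSucc)) K := Function.update 1 i h.1
    let φ (h : G i) : GL (Fin n) K := b (H h)
    have hφG (h : G i) : φ h ∈ GSet K n m hmono hlast G := by
      refine ⟨hb0 _, fun i' => ⟨H h i', ?_, hb _ i'⟩⟩
      by_cases hi' : i' = i
      · subst hi'
        rw [show H h i' = h.1 from Function.update_self ..]
        exact h.2
      · rw [show H h i' = 1 from Function.update_of_ne hi' ..]
        exact one_mem _
    refine mem_adjoin_aeval_of_forall_fixed B hy
      (fun h : G i => matAct (h.1 : Matrix _ _ K))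
      (fun h => matAct (φ h : Matrix (Fin n) (Fin n) K)) (fun h => ?_) (fun h j => ?_) (e i)
      (fun p hp => ?_) ih fun h => hf _ (hφG h)
    · refine mem_adjoin_of_forall_fixed _ ?_
      rintro _ ⟨⟨i', j⟩, hi', rfl⟩
      have hfix (p : MvPolynomial (Fin (m i'.succ - m i'.castSucc)) K) :
          matAct (φ h : Matrix (Fin n) (Fin n) K) (aeval (vij K n m hmono hlast i') p) =
            aeval (vij K n m hmono hlast i') p := by
        rw [matAct_aeval_vij hmono hlast hm0 _ (hb0 _) i' 1, matAct_one]
        intro j k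
        rw [hb, show H h i' = 1 from Function.update_of_ne hi' ..]
        rfl
      by_cases hS : i' ∈ S
      · rw [mixedGens_of_mem hmono hlast e hS, hfix]
      · rw [mixedGens_of_notMem hmono hlast e hS]
        simpa using hfix (X j)
    · rw [← matAct_aeval_vij hmono hlast hm0 _ (hb0 _) i, aeval_X]
      intro j k
      rw [hb, show H h i = h.1 from Function.update_self ..]
    · rw [hgen]
      exact fun h hh => hp ⟨h, hh⟩

lemma aeval_vij_mem_invariants (hm0 : m 0 = 0) {i : Fin l}
    {p : MvPolynomial (Fin (m i.succ - m i.castSucc)) K}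
    (hp : p ∈ invariants ((G i : Set (GL (Fin (m i.succ - m i.castSucc)) K)))) :
    aeval (vij K n m hmono hlast i) p ∈ invariants (GSet K n m hmono hlast G) := by
  intro g hg
  obtain ⟨h, hh, hgh⟩ := hg.2 i
  rw [matAct_aeval_vij hmono hlast hm0 g hg.1 i h hgh, hp h hh]

end Generators

/-- for a composition `I = (n_1, …, n_l)` of `n` (encoded by partial
sums `m`) and subgroups `G_i ≤ GL_{n_i}(F_q)`, assume that for each `i` the
invariant ring `F_q[y_1, …, y_{n_i}]^{G_i}` is the polynomial algebra on
algebraically independent homogeneous polynomials `e_{i,1}, …, e_{i,n_i}`.  Let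
`u_{i,j} = e_{i,j}(v_{i,1}, …, v_{i,n_i})`.  Then the `n` elements `u_{i,j}` are
algebraically independent over `F_q` and generate `P^{G_I}`. -/
theorem statement2 {K : Type*} [Field K] [Fintype K] {p r : ℕ} (hp : p.Prime)
    (hr : 0 < r) (hcard : Fintype.card K = p ^ r)
    (n l : ℕ) (hl : 0 < l) (m : Fin (l + 1) → ℕ)
    (hm0 : m 0 = 0) (hmono : StrictMono m) (hlast : m (Fin.last l) = n)
    (G : (i : Fin l) → Subgroup (GL (Fin (m i.succ - m i.castSucc)) K))
    (e : (i : Fin l) → Fin (m i.succ - m i.castSucc) →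
      MvPolynomial (Fin (m i.succ - m i.castSucc)) K)
    (hhom : ∀ i j, ∃ d, (e i j).IsHomogeneous d)
    (hind : ∀ i, AlgebraicIndependent K (e i))
    (hgen : ∀ i, Algebra.adjoin K (Set.range (e i)) =
      invariants ((G i : Set (GL (Fin (m i.succ - m i.castSucc)) K)))) :
    AlgebraicIndependent K
      (fun x : Σ i : Fin l, Fin (m i.succ - m i.castSucc) =>
        aeval (fun t => vij K n m hmono hlast x.1 t) (e x.1 x.2)) ∧
    Algebra.adjoin K
      (Set.range (fun x : Σ i : Fin l, Fin (m i.succ - m i.castSucc) =>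
        aeval (fun t => vij K n m hmono hlast x.1 t) (e x.1 x.2))) =
      invariants (GSet K n m hmono hlast G) := by
  have hu : mixedGens hmono hlast e Finset.univ =
      fun x => aeval (fun t => vij K n m hmono hlast x.1 t) (e x.1 x.2) :=
    funext fun x => mixedGens_of_mem hmono hlast e (Finset.mem_univ _) x.2
  refine ⟨hu ▸ algebraicIndependent_mixedGens hmono hlast e hm0 hind Finset.univ,
    le_antisymm (Algebra.adjoin_le ?_) fun f hf => ?_⟩
  · rintro _ ⟨⟨i, j⟩, rfl⟩
    refine aeval_vij_mem_invariants hmono hlast G hm0 ?_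
    rw [← hgen]
    exact Algebra.subset_adjoin ⟨j, rfl⟩
  · exact hu ▸ mem_adjoin_mixedGens hmono hlast e G hm0 hind hgen hf Finset.univ
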